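/- arXiv:1808.08181 — 2 statements merged into one kernel-verified Lean document; each statement's English description precedes it below -/
import Mathlib

section
/- Let ε > 0 and Δ > 0 be real numbers, let n be a positive natural number, and let a, a' : Fin n → ℝ be two vectors that agree at every coordinate except possibly one coordinate k₀, with |a k₀ − a' k₀| ≤ Δ. Then for every y : Fin n → ℝ, ∏_{k} (ε/(2Δ))·exp(−ε·|y k − a k|/Δ) ≤ exp(ε) · ∏_{k} (ε/(2Δ))·exp(−ε·|y k − a' k|/Δ). -/
theorem stmt_1 (ε Δ : ℝ) (hε : 0 < ε) (hΔ : 0 < Δ) (n : ℕ) (hn : 0 < n)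
    (a a' : Fin n → ℝ) (k₀ : Fin n)
    (hagree : ∀ k, k ≠ k₀ → a k = a' k)
    (hdiff : |a k₀ - a' k₀| ≤ Δ) (y : Fin n → ℝ) :
    ∏ k, (ε / (2 * Δ)) * Real.exp (-(ε * |y k - a k|) / Δ)
      ≤ Real.exp ε * ∏ k, (ε / (2 * Δ)) * Real.exp (-(ε * |y k - a' k|) / Δ) := by
  rw [← Finset.mul_prod_erase Finset.univ _ (Finset.mem_univ k₀),
    ← Finset.mul_prod_erase Finset.univ
      (fun k => (ε / (2 * Δ)) * Real.exp (-(ε * |y k - a' k|) / Δ)) (Finset.mem_univ k₀),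
    ← mul_assoc]
  have h1 : ∏ k ∈ Finset.univ.erase k₀, (ε / (2 * Δ)) * Real.exp (-(ε * |y k - a k|) / Δ)
      = ∏ k ∈ Finset.univ.erase k₀, (ε / (2 * Δ)) * Real.exp (-(ε * |y k - a' k|) / Δ) := by
    refine Finset.prod_congr rfl fun k hk => ?_
    rw [hagree k (Finset.ne_of_mem_erase hk)]
  rw [h1]
  refine mul_le_mul_of_nonneg_right ?_ (Finset.prod_nonneg fun k _ => by positivity)
  have h2 : Real.exp (-(ε * |y k₀ - a k₀|) / Δ)
      ≤ Real.exp ε * Real.exp (-(ε * |y k₀ - a' k₀|) / Δ) := by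
    rw [← Real.exp_add, Real.exp_le_exp, div_le_iff₀ hΔ, add_mul, div_mul_cancel₀ _ hΔ.ne']
    have h3 : |y k₀ - a' k₀| ≤ |y k₀ - a k₀| + |a k₀ - a' k₀| := abs_sub_le _ _ _
    have h4 : |y k₀ - a' k₀| ≤ |y k₀ - a k₀| + Δ := by linarith
    nlinarith [mul_le_mul_of_nonneg_left h4 hε.le]
  have h5 : 0 ≤ ε / (2 * Δ) := by positivity
  have h6 := mul_le_mul_of_nonneg_left h2 h5
  calc _ ≤ _ := h6
    _ = _ := by ring
end

section
/- Let ε > 0, Δ > 0, μ ∈ ℝ, c ∈ ℝ, σ > 0, and s ∈ [0,1]. Let X be a real random variable whose law is the mixture (1 − s)·δ_c + s·N(μ, σ²) (point mass at c with weight 1 − s and Gaussian of mean μ and variance σ² with weight s), and let L be an independent real random variable with density x ↦ (ε/(2Δ))·exp(−ε·|x|/Δ). Then E|μ − (X + L)| ≤ (1 − s)·(|μ − c| + Δ/ε) + s·(σ·√(2/π) + Δ/ε). -/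
open MeasureTheory

lemma lap_int (b : ℝ) (hb : 0 < b) :
    ∫ x : ℝ, (b / 2 * Real.exp (-(b * |x|))) * |x| = 1 / b := by
  rw [integral_comp_abs (f := fun x => (b / 2 * Real.exp (-(b * x))) * x)]
  have h := Real.integral_rpow_mul_exp_neg_mul_Ioi (a := 2) (r := b) (by norm_num) hb
  have h2 : ∫ x in Set.Ioi (0:ℝ), (b / 2 * Real.exp (-(b * x))) * x
      = b / 2 * ∫ x in Set.Ioi (0:ℝ), x ^ ((2:ℝ) - 1) * Real.exp (-(b * x)) := by
    rw [← integral_const_mul]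
    congr 1
    ext x
    norm_num
    ring
  rw [h2, h]
  norm_num
  field_simp

lemma gauss_int (μ σ : ℝ) (hσ : 0 < σ) :
    ∫ x : ℝ, |μ - x| ∂(ProbabilityTheory.gaussianReal μ ⟨σ ^ 2, sq_nonneg σ⟩)
      = σ * Real.sqrt (2 / Real.pi) := by
  have hv : (⟨σ ^ 2, sq_nonneg σ⟩ : NNReal) ≠ 0 := by
    intro h
    have h1 : σ ^ 2 = 0 := congrArg NNReal.toReal h
    have h2 : 0 < σ ^ 2 := by positivity
    linarith
  rw [ProbabilityTheory.integral_gaussianReal_eq_integral_smul hv]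
  simp only [ProbabilityTheory.gaussianPDFReal, smul_eq_mul]
  rw [← integral_add_right_eq_self _ μ]
  have e : ∀ x : ℝ, (√(2 * Real.pi * σ ^ 2))⁻¹ * Real.exp (-(x + μ - μ) ^ 2 / (2 * σ ^ 2)) *
      |μ - (x + μ)| = (fun y => (√(2 * Real.pi * σ ^ 2))⁻¹ * (y ^ (1:ℝ) *
        Real.exp (- (1 / (2 * σ ^ 2)) * y ^ (2:ℝ)))) |x| := by
    intro x
    have : |μ - (x + μ)| = |x| := by rw [← abs_neg]; congr 1; ring
    rw [this]
    simp only [Real.rpow_one, Real.rpow_two, sq_abs]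
    rw [show -(x + μ - μ) ^ 2 / (2 * σ ^ 2) = -(1 / (2 * σ ^ 2)) * x ^ 2 by ring]
    ring
  have e2 := integral_congr_ae (μ := volume) (Filter.Eventually.of_forall e)
  refine e2.trans ?_
  rw [integral_comp_abs (f := fun y => (√(2 * Real.pi * σ ^ 2))⁻¹ * (y ^ (1:ℝ) *
        Real.exp (- (1 / (2 * σ ^ 2)) * y ^ (2:ℝ)))), integral_const_mul,
    integral_rpow_mul_exp_neg_mul_rpow (by norm_num) (by norm_num) (by positivity)]
  norm_num
  rw [show ((-1:ℝ)) = -1 from rfl, Real.rpow_neg_one]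
  rw [Real.sqrt_mul (by positivity), Real.sqrt_mul (by norm_num), Real.sqrt_sq hσ.le]
  have h2 : √2 * √2 = (2:ℝ) := Real.mul_self_sqrt (by norm_num)
  have hp : 0 < √Real.pi := Real.sqrt_pos.2 Real.pi_pos
  field_simp
  nlinarith

theorem stmt_10 {Ω : Type*} [MeasurableSpace Ω] (P : Measure Ω)
    [IsProbabilityMeasure P]
    (ε Δ μ c σ s : ℝ) (hε : 0 < ε) (hΔ : 0 < Δ) (hσ : 0 < σ)
    (hs : s ∈ Set.Icc (0 : ℝ) 1)
    (X L : Ω → ℝ) (hX : Measurable X) (hL : Measurable L)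
    (hindep : ProbabilityTheory.IndepFun X L P)
    (hXlaw : Measure.map X P =
      ENNReal.ofReal (1 - s) • Measure.dirac c +
        ENNReal.ofReal s • ProbabilityTheory.gaussianReal μ ⟨σ ^ 2, sq_nonneg σ⟩)
    (hLlaw : Measure.map L P =
      volume.withDensity fun x =>
        ENNReal.ofReal ((ε / (2 * Δ)) * Real.exp (-(ε * |x|) / Δ))) :
    ∫ ω, |μ - (X ω + L ω)| ∂P
      ≤ (1 - s) * (|μ - c| + Δ / ε) + s * (σ * Real.sqrt (2 / Real.pi) + Δ / ε) := by
  obtain ⟨hs0, hs1⟩ := hs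
  have hLint : ∫ ω, |L ω| ∂P = Δ / ε := by
    have h1 : ∫ ω, |L ω| ∂P = ∫ x, |x| ∂(Measure.map L P) :=
      (integral_map hL.aemeasurable (by fun_prop)).symm
    rw [h1, hLlaw, integral_withDensity_eq_integral_toReal_smul (by fun_prop) (by simp)]
    have h2 := lap_int (ε / Δ) (by positivity)
    rw [one_div_div] at h2
    rw [← h2]
    congr 1
    ext x
    rw [ENNReal.toReal_ofReal (by positivity), smul_eq_mul]
    congr 2
    · field_simp
    · congr 1
      ring
  have hLi : Integrable (fun ω => |L ω|) P := by
    by_contra h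
    rw [integral_undef h] at hLint
    have : 0 < Δ / ε := by positivity
    linarith
  have hg0 : Integrable (fun x : ℝ => |μ - x|)
      (ProbabilityTheory.gaussianReal μ ⟨σ ^ 2, sq_nonneg σ⟩) := by
    by_contra h
    have h1 := gauss_int μ σ hσ
    rw [integral_undef h] at h1
    have : 0 < σ * Real.sqrt (2 / Real.pi) := by positivity
    linarith
  have hg := hg0.smul_measure (c := ENNReal.ofReal s) ENNReal.ofReal_ne_top
  have hd : Integrable (fun x : ℝ => |μ - x|) (ENNReal.ofReal (1 - s) • Measure.dirac c) :=
    (integrable_dirac (by simp)).smul_measure ENNReal.ofReal_ne_top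
  have hXi : Integrable (fun ω => |μ - X ω|) P := by
    have := hd.add_measure hg
    rw [← hXlaw] at this
    exact this.comp_measurable hX
  have hXint : ∫ ω, |μ - X ω| ∂P = (1 - s) * |μ - c| + s * (σ * Real.sqrt (2 / Real.pi)) := by
    have h1 : ∫ ω, |μ - X ω| ∂P = ∫ x, |μ - x| ∂(Measure.map X P) :=
      (integral_map (f := fun x : ℝ => |μ - x|) hX.aemeasurable
        (by fun_prop)).symm
    rw [h1, hXlaw, integral_add_measure hd hg, integral_smul_measure, integral_smul_measure,
      integral_dirac, gauss_int μ σ hσ, ENNReal.toReal_ofReal (by linarith),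
      ENNReal.toReal_ofReal hs0]
    rfl
  calc ∫ ω, |μ - (X ω + L ω)| ∂P ≤ ∫ ω, (|μ - X ω| + |L ω|) ∂P := by
        refine integral_mono_of_nonneg (Filter.Eventually.of_forall fun ω => abs_nonneg _)
          (hXi.add hLi) (Filter.Eventually.of_forall fun ω => ?_)
        have := abs_sub (μ - X ω) (L ω)
        simpa [sub_sub] using this
    _ = _ := by
        rw [integral_add hXi hLi, hXint, hLint]
        ring
end
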